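/- arXiv:1411.0029 — 4 statements merged into one kernel-verified Lean document; each statement's English description precedes it below -/
import Mathlib

section
/- Fix a positive integer n and a (weakly) increasing sequence a : ℕ → ℕ of positive integers. Define b_0 = 0 and b_{i+1} = a_{b_i + 1} + b_i + 1 for i = 0, …, n − 1. Equip ℕ² × Fin n with the partial order in which (ξ, i) ≤ (ζ, j) if and only if i = j and ξ ≤ ζ coordinatewise, and for ξ = (ξ_1, ξ_2) ∈ ℕ² write |ξ| = ξ_1 + ξ_2. If S_0 ⊊ S_1 ⊊ ⋯ ⊊ S_r is a strictly increasing chain of antichains of (ℕ² × Fin n, ≤) such that S_k ⊆ {(ξ, i) : |ξ| ≤ a_k} for every k ≤ r, then |S_r| ≤ b_n. -/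
/-- If an antichain of `ℕ² × ι` contains `p`, its part in the `p.2`-th copy has at most `|p| + 1`
elements. -/
theorem ncard_fiber_le_of_isAntichain {ι : Type*} {A : Set ((ℕ × ℕ) × ι)}
    (hA : IsAntichain (fun x y : (ℕ × ℕ) × ι => x.2 = y.2 ∧ x.1 ≤ y.1) A)
    {p : (ℕ × ℕ) × ι} (hp : p ∈ A) :
    {x ∈ A | x.2 = p.2}.ncard ≤ p.1.1 + p.1.2 + 1 := by
  have comparable_eq : ∀ x ∈ A, ∀ y ∈ A, x.2 = y.2 → x.1.1 ≤ y.1.1 → x.1.2 ≤ y.1.2 → x = y :=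
    fun x hx y hy h h₁ h₂ => hA.eq hx hy ⟨h, Prod.mk_le_mk.2 ⟨h₁, h₂⟩⟩
  have second_le : ∀ x ∈ A, x.2 = p.2 → p.1.1 ≤ x.1.1 → x.1.2 ≤ p.1.2 := by
    intro x hx h h₁
    by_contra! h₂
    have := comparable_eq p hp x hx h.symm h₁ h₂.le
    subst this
    omega
  let f : (ℕ × ℕ) × ι → ℕ := fun x => if x.1.1 < p.1.1 then x.1.1 else p.1.1 + x.1.2
  have hmaps : ∀ x ∈ {x ∈ A | x.2 = p.2}, f x ∈ (Finset.range (p.1.1 + p.1.2 + 1) : Set ℕ) := by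
    rintro x ⟨hx, h⟩
    have := second_le x hx h
    simp only [f, Finset.coe_range, Set.mem_Iio]
    split_ifs <;> omega
  have hinj : Set.InjOn f {x ∈ A | x.2 = p.2} := by
    rintro x ⟨hx, h⟩ y ⟨hy, h'⟩ hxy
    have hxy' := comparable_eq x hx y hy (h.trans h'.symm)
    have hyx' := comparable_eq y hy x hx (h'.trans h.symm)
    simp only [f] at hxy
    rcases le_total x.1.1 y.1.1 with h₁ | h₁ <;> rcases le_total x.1.2 y.1.2 with h₂ | h₂
    · exact hxy' h₁ h₂
    · split_ifs at hxy
      · exact (hyx' (by omega) h₂).symm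
      · omega
      · omega
      · exact hxy' h₁ (by omega)
    · split_ifs at hxy
      · exact hxy' (by omega) h₂
      · omega
      · omega
      · exact (hyx' h₁ (by omega)).symm
    · exact (hyx' h₁ h₂).symm
  simpa using Set.ncard_le_ncard_of_injOn f hmaps hinj (Finset.finite_toSet _)

theorem finite_setOf_add_le {ι : Type*} [Finite ι] (d : ℕ) :
    {x : (ℕ × ℕ) × ι | x.1.1 + x.1.2 ≤ d}.Finite := by
  refine (((Set.finite_Iic d).prod (Set.finite_Iic d)).prod
    (Set.finite_univ (α := ι))).subset fun x hx => ?_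
  simp only [Set.mem_ofPred_eq] at hx
  simp only [Set.mem_prod, Set.mem_Iic, Set.mem_univ, and_true]
  omega

/-- The `k`-th member of a strictly increasing chain of sets has at least `k` elements. -/
theorem le_ncard_of_ssubset_chain {α : Type*} {S : ℕ → Set α} {r : ℕ}
    (hfin : ∀ k ≤ r, (S k).Finite) (hchain : ∀ k < r, S k ⊂ S (k + 1)) :
    ∀ k ≤ r, k ≤ (S k).ncard := by
  intro k
  induction k with
  | zero => simp
  | succ k ih =>
    intro hk
    have := Set.ncard_lt_ncard (hchain k hk) (hfin _ hk)
    have := ih (by omega)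
    omega

/-- On `ℕ² × Fin n` with the order `(ξ, i) ≤ (ζ, j) ↔ i = j ∧ ξ ≤ ζ` (coordinatewise):
if `S 0 ⊊ S 1 ⊊ ⋯ ⊊ S r` is a strictly increasing chain of antichains with
`S k ⊆ {(ξ, i) : |ξ| ≤ a k}` for all `k ≤ r`, where `a` is a weakly increasing
sequence of positive integers, then `|S r| ≤ b n`, where `b 0 = 0` and
`b (i+1) = a (b i + 1) + b i + 1` for `i = 0, …, n − 1`. -/
theorem antichain_chain_card_bound_two (n : ℕ) (hn : 0 < n)
    (a : ℕ → ℕ) (ha : ∀ i, 0 < a i) (hmono : Monotone a)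
    (b : ℕ → ℕ) (hb0 : b 0 = 0) (hb : ∀ i < n, b (i + 1) = a (b i + 1) + b i + 1)
    (r : ℕ) (S : ℕ → Set ((ℕ × ℕ) × Fin n))
    (hanti : ∀ k ≤ r,
      IsAntichain (fun x y : (ℕ × ℕ) × Fin n => x.2 = y.2 ∧ x.1 ≤ y.1) (S k))
    (hchain : ∀ k < r, S k ⊂ S (k + 1))
    (hbound : ∀ k ≤ r, S k ⊆ {x : (ℕ × ℕ) × Fin n | x.1.1 + x.1.2 ≤ a k}) :
    (S r).ncard ≤ b n := by
  have hfin : ∀ k ≤ r, (S k).Finite := fun k hk =>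
    (finite_setOf_add_le (a k)).subset (hbound k hk)
  have hcard := le_ncard_of_ssubset_chain hfin hchain
  have hsub : ∀ k ≤ r, S k ⊆ S r := fun k hk =>
    Nat.decreasingInduction' (P := fun k => S k ⊆ S r)
      (fun m hm _ ih => (hchain m hm).subset.trans ih) hk subset_rfl
  have key : ∀ j ≤ n, ∃ T : Finset (Fin n), T.card = j ∧ {x ∈ S r | x.2 ∈ T}.ncard ≤ b j := by
    intro j
    induction j with
    | zero => exact fun _ => ⟨∅, by simp⟩
    | succ j ih =>
      intro hj
      obtain ⟨T, hT, hTb⟩ := ih (by omega)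
      have hbj := hb j hj
      by_cases hex : ∃ k, k ≤ r ∧ ∃ x ∈ S k, x.2 ∉ T
      · classical
        obtain ⟨hk, p, hp, hpT⟩ := Nat.find_spec hex
        have hmin := fun m => Nat.find_min hex (m := m)
        generalize Nat.find hex = k at hk hp hmin
        refine ⟨insert p.2 T, by rw [Finset.card_insert_of_notMem hpT, hT], ?_⟩
        have hkb : k ≤ b j + 1 := by
          rcases k with _ | m
          · omega
          · have hsubT : S m ⊆ {x ∈ S r | x.2 ∈ T} := fun x hx =>
              ⟨hsub m (by omega) hx, by
                by_contra hxT
                exact hmin m (by omega) ⟨by omega, x, hx, hxT⟩⟩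
            have := Set.ncard_le_ncard hsubT ((hfin r le_rfl).subset (Set.sep_subset _ _))
            have := hcard m (by omega)
            omega
        have hpa : p.1.1 + p.1.2 ≤ a k := hbound k hk hp
        have hak := hmono hkb
        have hfiber := ncard_fiber_le_of_isAntichain (hanti r le_rfl) (hsub k hk hp)
        have hunion : {x ∈ S r | x.2 ∈ insert p.2 T} =
            {x ∈ S r | x.2 = p.2} ∪ {x ∈ S r | x.2 ∈ T} := by
          ext x
          simp only [Finset.mem_insert, Set.mem_ofPred_eq, Set.mem_union]
          tauto
        rw [hunion]
        have := Set.ncard_union_le {x ∈ S r | x.2 = p.2} {x ∈ S r | x.2 ∈ T}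
        omega
      · push Not at hex
        obtain ⟨T', hTT', -, hT'⟩ := Finset.exists_subsuperset_card_eq (Finset.subset_univ T)
          (n := j + 1) (by omega) (by simpa using hj)
        refine ⟨T', hT', ?_⟩
        have hsubT : {x ∈ S r | x.2 ∈ T'} ⊆ {x ∈ S r | x.2 ∈ T} := fun x hx =>
          ⟨hx.1, hex r le_rfl x hx.1⟩
        have := Set.ncard_le_ncard hsubT ((hfin r le_rfl).subset (Set.sep_subset _ _))
        omega
  obtain ⟨T, hT, hTb⟩ := key n le_rfl
  obtain rfl : T = Finset.univ := Finset.card_eq_iff_eq_univ T |>.1 (by simpa using hT)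
  simpa using hTb
end

section
/- Fix a positive integer n and a (weakly) increasing sequence a : ℕ → ℕ of positive integers. Define b_0 = 0 and b_{i+1} = a_{b_i + 1} + b_i + 1 for i = 0, …, n − 1, and set t = b_n + 1. Then every chain S_0 ⊆ S_1 ⊆ ⋯ ⊆ S_t of antichains of (ℕ² × Fin n, ≤) — where (ξ, i) ≤ (ζ, j) if and only if i = j and ξ ≤ ζ coordinatewise — satisfying S_k ⊆ {(ξ, i) : |ξ| ≤ a_k} for every k ≤ t, is not strictly increasing, i.e., S_k = S_{k+1} for some k < t. -/
/-- A finite family of pairwise incomparable points of `ℕ²` containing `(u, v)` has at most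
`u + v + 1` members. -/
theorem card_le_of_pairwise_not_le {ι : Type*} (s : Finset ι) (x : ι → ℕ × ℕ)
    (hx : ∀ p ∈ s, ∀ q ∈ s, p ≠ q → ¬ x p ≤ x q) {m : ι} (hm : m ∈ s) :
    s.card ≤ (x m).1 + (x m).2 + 1 := by
  rw [← Finset.card_range ((x m).1 + (x m).2 + 1)]
  simp only [Prod.le_def] at hx
  refine Finset.card_le_card_of_injOn
    (fun p => if (x p).1 ≤ (x m).1 then (x p).1 else (x m).1 + 1 + (x p).2) ?_ ?_
  · intro p hp
    have hp : p ∈ s := hp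
    simp only [Finset.coe_range, Set.mem_Iio]
    split_ifs with h
    · omega
    · have hne : m ≠ p := by rintro rfl; exact h le_rfl
      have := hx m hm p hp hne
      omega
  · intro p hp q hq hpq
    by_contra hne
    have hpq' := hx p hp q hq hne
    have hqp' := hx q hq p hp (Ne.symm hne)
    simp only at hpq
    split_ifs at hpq <;> omega

/-- If the points `x 0, …, x (t - 1)` of `ℕ² × Fin n` are pairwise incomparable with
`|x k| ≤ a (k + 1)`, and `t > b j` for all `j ≤ n`, then for each `j ≤ n` some `j` components
together contain at most `b j` of the points. -/
theorem exists_components_card_le {n t : ℕ} {a b : ℕ → ℕ} (hmono : Monotone a)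
    (hb : ∀ i < n, b (i + 1) = a (b i + 1) + b i + 1) (ht : ∀ i ≤ n, b i < t)
    (x : ℕ → (ℕ × ℕ) × Fin n)
    (hx : ∀ p < t, ∀ q < t, p ≠ q → (x p).2 = (x q).2 → ¬ (x p).1 ≤ (x q).1)
    (hdeg : ∀ k < t, (x k).1.1 + (x k).1.2 ≤ a (k + 1)) (j : ℕ) (hj : j ≤ n) :
    ∃ C : Finset (Fin n), C.card = j ∧
      ((Finset.range t).filter fun k => (x k).2 ∈ C).card ≤ b j := by
  induction j with
  | zero => exact ⟨∅, by simp⟩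
  | succ j ih =>
    obtain ⟨C, hC, hcard⟩ := ih (by omega)
    have hlt := ht j (by omega)
    obtain ⟨m, hm, hmC⟩ : ∃ m < b j + 1, (x m).2 ∉ C := by
      by_contra! h
      have hsub : Finset.range (b j + 1) ⊆ (Finset.range t).filter fun k => (x k).2 ∈ C := by
        intro k hk
        rw [Finset.mem_range] at hk
        exact Finset.mem_filter.2 ⟨Finset.mem_range.2 (by omega), h k hk⟩
      have := Finset.card_le_card hsub
      rw [Finset.card_range] at this
      omega
    refine ⟨insert (x m).2 C, by rw [Finset.card_insert_of_notMem hmC, hC], ?_⟩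
    have hcol : ((Finset.range t).filter fun k => (x k).2 = (x m).2).card ≤
        (x m).1.1 + (x m).1.2 + 1 := by
      refine card_le_of_pairwise_not_le _ (fun k => (x k).1) ?_ (m := m) ?_
      · intro p hp q hq hne
        rw [Finset.mem_filter, Finset.mem_range] at hp hq
        exact hx p hp.1 q hq.1 hne (hp.2.trans hq.2.symm)
      · exact Finset.mem_filter.2 ⟨Finset.mem_range.2 (by omega), rfl⟩
    have hdm := hdeg m (by omega)
    have ham : a (m + 1) ≤ a (b j + 1) := hmono (by omega)
    have hbj := hb j (by omega)
    simp only [Finset.mem_insert]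
    rw [Finset.filter_or]
    refine (Finset.card_union_le _ _).trans ?_
    omega


/-- On `ℕ² × Fin n` with the order `(ξ, i) ≤ (ζ, j) ↔ i = j ∧ ξ ≤ ζ` (coordinatewise):
with `b 0 = 0`, `b (i+1) = a (b i + 1) + b i + 1` for `i = 0, …, n − 1`, and
`t = b n + 1`, every chain `S 0 ⊆ S 1 ⊆ ⋯ ⊆ S t` of antichains satisfying
`S k ⊆ {(ξ, i) : |ξ| ≤ a k}` for all `k ≤ t` is not strictly increasing,
i.e. `S k = S (k+1)` for some `k < t`. -/
theorem antichain_chain_stabilizes_two (n : ℕ) (hn : 0 < n)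
    (a : ℕ → ℕ) (ha : ∀ i, 0 < a i) (hmono : Monotone a)
    (b : ℕ → ℕ) (hb0 : b 0 = 0) (hb : ∀ i < n, b (i + 1) = a (b i + 1) + b i + 1)
    (S : ℕ → Set ((ℕ × ℕ) × Fin n))
    (hanti : ∀ k ≤ b n + 1,
      IsAntichain (fun x y : (ℕ × ℕ) × Fin n => x.2 = y.2 ∧ x.1 ≤ y.1) (S k))
    (hchain : ∀ k < b n + 1, S k ⊆ S (k + 1))
    (hbound : ∀ k ≤ b n + 1, S k ⊆ {x : (ℕ × ℕ) × Fin n | x.1.1 + x.1.2 ≤ a k}) :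
    ∃ k < b n + 1, S k = S (k + 1) := by
  by_contra! hne
  have hle : ∀ i ≤ n, b i ≤ b n := by
    intro i hi
    induction hi using Nat.decreasingInduction with
    | self => exact le_rfl
    | of_succ k hk ih =>
      have := hb k hk
      omega
  have hsub : ∀ q ≤ b n + 1, ∀ p ≤ q, S p ⊆ S q := by
    intro q hq p hpq
    induction q, hpq using Nat.le_induction with
    | base => exact subset_rfl
    | succ q _ ih => exact (ih (by omega)).trans (hchain q (by omega))
  have hnew : ∀ k, ∃ y, k < b n + 1 → y ∈ S (k + 1) ∧ y ∉ S k := by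
    intro k
    by_cases hk : k < b n + 1
    · obtain ⟨y, hy⟩ := Set.exists_of_ssubset ((hchain k hk).ssubset_of_ne (hne k hk))
      exact ⟨y, fun _ => hy⟩
    · exact ⟨((0, 0), ⟨0, hn⟩), fun h => absurd h hk⟩
  choose x hx using hnew
  have hinj : ∀ p q, p < q → q < b n + 1 → x p ≠ x q := by
    intro p q hpq hq h
    exact (hx q hq).2 (h ▸ hsub q (by omega) (p + 1) hpq (hx p (by omega)).1)
  have hmem : ∀ k < b n + 1, x k ∈ S (b n + 1) := fun k hk =>
    hsub _ le_rfl (k + 1) hk (hx k hk).1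
  obtain ⟨C, hC, hcard⟩ := exists_components_card_le hmono hb
    (fun i hi => Nat.lt_succ_of_le (hle i hi)) x
    (fun p hp q hq hpq hcol hpq' => by
      have hxne : x p ≠ x q := by
        rcases Nat.lt_or_gt_of_ne hpq with h | h
        · exact hinj p q h hq
        · exact (hinj q p h hp).symm
      exact hanti _ le_rfl (hmem p hp) (hmem q hq) hxne ⟨hcol, hpq'⟩)
    (fun k hk => hbound (k + 1) hk (hx k hk).1) n le_rfl
  have hCuniv : C = Finset.univ := (Finset.card_eq_iff_eq_univ C).1 (by simpa using hC)
  simp [hCuniv] at hcard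
end

section
/- For all positive integers m, n and every (weakly) increasing sequence a : ℕ → ℕ of positive integers, there exists t ∈ ℕ (depending only on m, n, and the sequence a) such that every chain S_0 ⊆ S_1 ⊆ ⋯ ⊆ S_t of antichains of (ℕ^m × Fin n, ≤) — where (ξ, i) ≤ (ζ, j) if and only if i = j and ξ ≤ ζ coordinatewise — satisfying S_k ⊆ {(ξ, i) : |ξ| ≤ a_k} for every k ≤ t, is not strictly increasing, i.e., S_k = S_{k+1} for some k < t. -/
open Filter in
/-- If `r` is a well-quasi-order and the sets `F k` are finite, then there is a uniform bound on the
length of strictly increasing chains of `r`-antichains whose `k`-th member lies in `F k`. -/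
theorem WellQuasiOrdered.exists_antichain_chain_bound {α : Type*} {r : α → α → Prop}
    (hr : WellQuasiOrdered r) {F : ℕ → Set α} (hF : ∀ k, (F k).Finite) :
    ∃ t : ℕ, ∀ S : ℕ → Set α, (∀ k ≤ t, IsAntichain r (S k)) → (∀ k < t, S k ⊆ S (k + 1)) →
      (∀ k ≤ t, S k ⊆ F k) → ∃ k < t, S k = S (k + 1) := by
  by_contra! h
  choose S hanti hsub hmem hne using h
  -- The limit of the counterexamples along a nonprincipal ultrafilter is an infinite chain.
  let U : Ultrafilter ℕ := hyperfilter ℕ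
  have hU (k : ℕ) : ∀ᶠ t in U, k < t :=
    Nat.hyperfilter_le_atTop (eventually_gt_atTop k)
  let L : ℕ → Set α := fun k => {x | ∀ᶠ t in U, x ∈ S t k}
  have hLmono : Monotone L := monotone_nat_of_le_succ fun k x hx => by
    filter_upwards [hx, hU k] with t hxt hkt using hsub t k hkt hxt
  have hLanti (k : ℕ) : IsAntichain r (L k) := fun x hx y hy hxy hrxy => by
    obtain ⟨t, hxt, hyt, hkt⟩ := (hx.and (hy.and (hU k))).exists
    exact hanti t k hkt.le hxt hyt hxy hrxy
  have hLnew (k : ℕ) : ∃ x ∈ L (k + 1), x ∉ L k := by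
    have hev : ∀ᶠ t in U, ∃ x ∈ F (k + 1), x ∈ S t (k + 1) ∧ x ∉ S t k := by
      filter_upwards [hU k] with t hkt
      obtain ⟨x, hx, hxk⟩ := Set.exists_of_ssubset ((hsub t k hkt).ssubset_of_ne (hne t k hkt))
      exact ⟨x, hmem t (k + 1) hkt hx, hx, hxk⟩
    obtain ⟨x, -, hx⟩ := (Ultrafilter.eventually_exists_mem_iff (hF (k + 1))).1 hev
    exact ⟨x, hx.mono fun _ => And.left,
      Ultrafilter.eventually_not.1 (hx.mono fun _ => And.right)⟩
  choose x hx hxn using hLnew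
  obtain ⟨i, j, hij, hrij⟩ := hr x
  have hij' : x i ∈ L j := hLmono hij (hx i)
  exact hLanti (j + 1) (hLmono j.le_succ hij') (hx j)
    (fun heq => hxn j (heq ▸ hij')) hrij

/-- Effective Dickson-type bound: for all positive integers `m, n` and every weakly
increasing sequence `a : ℕ → ℕ` of positive integers there is `t ∈ ℕ` such that every
chain `S 0 ⊆ S 1 ⊆ ⋯ ⊆ S t` of antichains of `ℕ^m × Fin n` (ordered by
`(ξ, i) ≤ (ζ, j) ↔ i = j ∧ ξ ≤ ζ` coordinatewise) with `S k ⊆ {(ξ, i) : |ξ| ≤ a k}`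
for all `k ≤ t` is not strictly increasing. -/
theorem exists_antichain_chain_stabilization_bound (m n : ℕ) (hm : 0 < m) (hn : 0 < n)
    (a : ℕ → ℕ) (ha : ∀ i, 0 < a i) (hmono : Monotone a) :
    ∃ t : ℕ, ∀ S : ℕ → Set ((Fin m → ℕ) × Fin n),
      (∀ k ≤ t, IsAntichain
        (fun x y : (Fin m → ℕ) × Fin n => x.2 = y.2 ∧ ∀ i, x.1 i ≤ y.1 i) (S k)) →
      (∀ k < t, S k ⊆ S (k + 1)) →
      (∀ k ≤ t, S k ⊆ {x : (Fin m → ℕ) × Fin n | (∑ i, x.1 i) ≤ a k}) →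
      ∃ k < t, S k = S (k + 1) := by
  have hr : WellQuasiOrdered
      (fun x y : (Fin m → ℕ) × Fin n => x.2 = y.2 ∧ ∀ i, x.1 i ≤ y.1 i) := fun f => by
    obtain ⟨i, j, hij, hle, heq⟩ :=
      ((wellQuasiOrdered_le (α := Fin m → ℕ)).prod (Finite.wellQuasiOrdered (α := Fin n) Eq)) f
    exact ⟨i, j, hij, heq, hle⟩
  refine hr.exists_antichain_chain_bound fun k =>
    ((Set.finite_Iic fun _ : Fin m => a k).prod (Set.finite_univ (α := Fin n))).subset ?_
  exact fun x hx => ⟨fun i => (Finset.single_le_sum_of_canonicallyOrdered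
    (Finset.mem_univ i)).trans hx, Set.mem_univ _⟩
end

section
/- Let K be a commutative ring containing ℚ (a ℚ-algebra) and let δ_1, …, δ_m : K → K be pairwise commuting derivations. Fix ℓ ∈ ℕ and let K_ℓ = K[ε_1, …, ε_m]/(ε_1, …, ε_m)^{ℓ+1} be the quotient of the polynomial ring in m variables by the (ℓ+1)-st power of the ideal generated by ε_1, …, ε_m. Then the map e : K → K_ℓ defined by e(a) = Σ_{ξ ∈ ℕ^m, |ξ| ≤ ℓ} (1/(ξ_1! ⋯ ξ_m!)) · δ^ξ(a) · ε_1^{ξ_1} ⋯ ε_m^{ξ_m}, where δ^ξ = δ_m^{ξ_m} ∘ ⋯ ∘ δ_1^{ξ_1}, is a ring homomorphism extending (on constants) the identity modulo (ε_1, …, ε_m). -/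
open Finset

namespace Derivation

variable {K : Type*} [CommRing K] [Algebra ℚ K]

/-- The divided power `d ^ n / n!` of a derivation. -/
noncomputable def divPow (d : Derivation ℚ K K) (n : ℕ) : K →ₗ[ℚ] K :=
  ((n.factorial : ℚ)⁻¹) • (d : K →ₗ[ℚ] K) ^ n

lemma divPow_apply (d : Derivation ℚ K K) (n : ℕ) (a : K) :
    d.divPow n a = ((n.factorial : ℚ)⁻¹) • d^[n] a := by
  simp [divPow, Module.End.pow_apply]

lemma iterate_apply_mul (d : Derivation ℚ K K) (n : ℕ) (a b : K) :
    d^[n] (a * b) = ∑ p ∈ antidiagonal n, n.choose p.1 • (d^[p.1] a * d^[p.2] b) := by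
  induction n with
  | zero => simp
  | succ n ih =>
    rw [sum_antidiagonal_choose_succ_nsmul (fun i j => d^[i] a * d^[j] b) n]
    simp only [Function.iterate_succ_apply', ih, map_sum, map_nsmul, leibniz, smul_add,
      sum_add_distrib, smul_eq_mul]
    congr 1
    refine sum_congr rfl fun p hp => ?_
    rw [n.choose_symm_of_eq_add (mem_antidiagonal.1 hp).symm, mul_comm]

lemma divPow_mul (d : Derivation ℚ K K) (n : ℕ) (a b : K) :
    d.divPow n (a * b) = ∑ p ∈ antidiagonal n, d.divPow p.1 a * d.divPow p.2 b := by
  simp only [divPow_apply, iterate_apply_mul, smul_sum]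
  refine sum_congr rfl fun p hp => ?_
  obtain rfl := mem_antidiagonal.1 hp
  rw [smul_mul_smul_comm, ← Nat.cast_smul_eq_nsmul ℚ, smul_smul, Nat.choose_symm_add, Nat.add_choose,
    Nat.cast_div (Nat.factorial_mul_factorial_dvd_factorial_add _ _) (by positivity)]
  congr 1
  push_cast
  field_simp

/-- The divided multi-power `d_m ^ ξ_m ∘ ⋯ ∘ d_1 ^ ξ_1 / (ξ_1! ⋯ ξ_m!)`. -/
noncomputable def multiDivPow {m : ℕ} (d : Fin m → Derivation ℚ K K) (ξ : Fin m → ℕ) (a : K) : K :=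
  ((∏ i, ((ξ i).factorial : ℚ))⁻¹) •
    (List.ofFn fun i => (d i)^[ξ i]).reverse.foldr (· ∘ ·) id a

lemma multiDivPow_succ {m : ℕ} (d : Fin (m + 1) → Derivation ℚ K K) (ξ : Fin (m + 1) → ℕ) (a : K) :
    multiDivPow d ξ a =
      (d (Fin.last m)).divPow (ξ (Fin.last m)) (multiDivPow (Fin.init d) (Fin.init ξ) a) := by
  rw [multiDivPow, multiDivPow, _root_.map_smul, divPow_apply]
  simp only [List.ofFn_succ', List.concat_eq_append,
    List.reverse_append, List.reverse_singleton, List.singleton_append, List.foldr_cons,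
    Function.comp_apply, Fin.prod_univ_castSucc, mul_inv, mul_smul]
  rfl

lemma multiDivPow_add {m : ℕ} (d : Fin m → Derivation ℚ K K) (ξ : Fin m → ℕ) (a b : K) :
    multiDivPow d ξ (a + b) = multiDivPow d ξ a + multiDivPow d ξ b := by
  induction m with
  | zero => simp [multiDivPow]
  | succ m ih => simp [multiDivPow_succ, ih]

lemma multiDivPow_zero {m : ℕ} (d : Fin m → Derivation ℚ K K) (a : K) :
    multiDivPow d 0 a = a := by
  induction m with
  | zero => simp [multiDivPow]
  | succ m ih =>
    rw [multiDivPow_succ, show Fin.init (0 : Fin (m + 1) → ℕ) = 0 from rfl, ih]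
    simp [divPow_apply]

lemma divPow_one_of_ne_zero (d : Derivation ℚ K K) {n : ℕ} (hn : n ≠ 0) : d.divPow n 1 = 0 := by
  obtain ⟨n, rfl⟩ := Nat.exists_eq_succ_of_ne_zero hn
  simp [divPow_apply]

lemma multiDivPow_one_of_ne_zero {m : ℕ} (d : Fin m → Derivation ℚ K K) {ξ : Fin m → ℕ}
    (hξ : ξ ≠ 0) : multiDivPow d ξ 1 = 0 := by
  induction m with
  | zero => exact absurd (Subsingleton.elim _ _) hξ
  | succ m ih =>
    rw [multiDivPow_succ]
    by_cases h : Fin.init ξ = 0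
    · rw [h, multiDivPow_zero]
      refine divPow_one_of_ne_zero _ fun h' => hξ ?_
      rw [← Fin.snoc_init_self ξ, h, h']
      ext i
      refine Fin.lastCases ?_ (fun j => ?_) i <;> simp
    · rw [ih _ h, map_zero]

lemma multiDivPow_mul {m : ℕ} (d : Fin m → Derivation ℚ K K) (ξ : Fin m → ℕ) (a b : K) :
    multiDivPow d ξ (a * b) = ∑ p ∈ Fintype.piFinset fun i => antidiagonal (ξ i),
      multiDivPow d (fun i => (p i).1) a * multiDivPow d (fun i => (p i).2) b := by
  induction m with
  | zero => simp [multiDivPow]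
  | succ m ih =>
    have hsum := Finset.filter_piFinset_eq_map_snocEquiv (n := m) (α := fun _ => ℕ × ℕ)
      (S := fun i => antidiagonal (ξ i)) (fun _ => True)
    simp only [filter_true] at hsum
    rw [hsum, sum_map, sum_product_right, multiDivPow_succ, ih, map_sum]
    refine sum_congr rfl fun p _ => ?_
    rw [divPow_mul]
    refine sum_congr rfl fun q _ => ?_
    simp only [multiDivPow_succ, Equiv.coe_toEmbedding, Fin.snocEquiv_apply, Fin.snoc_last]
    congr 3 <;> (ext i; simp [Fin.init])

/-- A Leibniz rule summed over any finite set of pairs containing all the decompositions of `ξ`. -/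
lemma multiDivPow_mul_eq_sum_filter {m : ℕ} (d : Fin m → Derivation ℚ K K) (ξ : Fin m → ℕ)
    (S : Finset ((Fin m → ℕ) × (Fin m → ℕ))) (hS : ∀ p, p.1 + p.2 = ξ → p ∈ S) (a b : K) :
    multiDivPow d ξ (a * b) =
      ∑ p ∈ S with p.1 + p.2 = ξ, multiDivPow d p.1 a * multiDivPow d p.2 b := by
  rw [multiDivPow_mul]
  refine sum_bij' (fun p _ => (fun i => (p i).1, fun i => (p i).2)) (fun p _ i => (p.1 i, p.2 i))
    ?_ ?_ (fun _ _ => rfl) (fun _ _ => rfl) (fun _ _ => rfl)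
  · intro p hp
    have : (fun i => (p i).1) + (fun i => (p i).2) = ξ := by
      ext i
      simpa using Fintype.mem_piFinset.1 hp i
    exact mem_filter.2 ⟨hS _ this, this⟩
  · intro p hp
    simpa [funext_iff] using (mem_filter.1 hp).2

end Derivation

/-- An additive map on a `ℚ`-algebra satisfying the Leibniz rule is a `ℚ`-derivation. -/
def Derivation.ofAddLeibniz {K : Type*} [CommRing K] [Algebra ℚ K] (δ : K → K)
    (hadd : ∀ a b, δ (a + b) = δ a + δ b) (hleib : ∀ a b, δ (a * b) = a * δ b + b * δ a) :
    Derivation ℚ K K :=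
  Derivation.mk' (AddMonoidHom.mk' δ hadd).toRatLinearMap hleib

lemma MvPolynomial.prod_X_pow_mem_pow_span_range_X {σ R : Type*} [Fintype σ] [CommRing R]
    (ξ : σ → ℕ) {n : ℕ} (hn : n ≤ ∑ i, ξ i) :
    (∏ i, X i ^ ξ i : MvPolynomial σ R) ∈ Ideal.span (Set.range X) ^ n := by
  refine Ideal.pow_le_pow_right hn ?_
  rw [← prod_pow_eq_pow_sum]
  exact Ideal.prod_mem_prod fun i _ =>
    Ideal.pow_mem_pow (Ideal.subset_span (Set.mem_range_self i)) _

/-- Let `K` be a commutative `ℚ`-algebra with pairwise commuting derivations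
`δ 1, …, δ m`. For `ℓ ∈ ℕ`, let `K_ℓ = K[ε_1, …, ε_m]/(ε_1, …, ε_m)^{ℓ+1}`. Then the
exponential map `e : K → K_ℓ`,
`e a = Σ_{|ξ| ≤ ℓ} (1/(ξ_1! ⋯ ξ_m!)) · δ^ξ a · ε^ξ` with `δ^ξ = δ_m^{ξ_m} ∘ ⋯ ∘ δ_1^{ξ_1}`,
is a ring homomorphism which reduces to the identity modulo `(ε_1, …, ε_m)`. -/
theorem exponential_map_is_ring_hom (K : Type*) [CommRing K] [Algebra ℚ K]
    (m : ℕ) (hm : 0 < m) (δ : Fin m → K → K)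
    (hadd : ∀ i a b, δ i (a + b) = δ i a + δ i b)
    (hleib : ∀ i a b, δ i (a * b) = a * δ i b + b * δ i a)
    (hcomm : ∀ i j a, δ i (δ j a) = δ j (δ i a)) (ℓ : ℕ) :
    let I : Ideal (MvPolynomial (Fin m) K) :=
      Ideal.span (Set.range (MvPolynomial.X : Fin m → MvPolynomial (Fin m) K))
    let π : MvPolynomial (Fin m) K →+* MvPolynomial (Fin m) K ⧸ I ^ (ℓ + 1) :=
      Ideal.Quotient.mk (I ^ (ℓ + 1))
    -- `D ξ = δ_m^{ξ_m} ∘ ⋯ ∘ δ_1^{ξ_1}`, applying `δ_1` first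
    let D : (Fin m → ℕ) → K → K := fun ξ =>
      (List.ofFn fun i : Fin m => (δ i)^[ξ i]).reverse.foldr (· ∘ ·) id
    -- `Γ` is the finite set of multi-indices `ξ` with `|ξ| ≤ ℓ`
    let Γ : Finset (Fin m → ℕ) :=
      (Fintype.piFinset fun _ : Fin m => Finset.range (ℓ + 1)).filter
        fun ξ => (∑ i, ξ i) ≤ ℓ
    let e : K → MvPolynomial (Fin m) K ⧸ I ^ (ℓ + 1) := fun a =>
      ∑ ξ ∈ Γ, π (MvPolynomial.C
          (algebraMap ℚ K (∏ i, ((ξ i).factorial : ℚ))⁻¹ * D ξ a)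
        * ∏ i, MvPolynomial.X i ^ ξ i)
    e 1 = 1 ∧
    (∀ a b, e (a + b) = e a + e b) ∧
    (∀ a b, e (a * b) = e a * e b) ∧
    (∀ a, e a - π (MvPolynomial.C a) ∈ Ideal.map π I) := by
  intro I π D Γ e
  let d : Fin m → Derivation ℚ K K := fun i => Derivation.ofAddLeibniz (δ i) (hadd i) (hleib i)
  let T := Derivation.multiDivPow d
  let M : (Fin m → ℕ) → MvPolynomial (Fin m) K := fun ξ => ∏ i, MvPolynomial.X i ^ ξ i
  have mem_Γ (ξ : Fin m → ℕ) : ξ ∈ Γ ↔ ∑ i, ξ i ≤ ℓ := by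
    simp only [Γ, mem_filter, Fintype.mem_piFinset, mem_range, and_iff_right_iff_imp]
    exact fun h i => Nat.lt_succ_of_le ((single_le_sum (fun _ _ => Nat.zero_le _)
      (mem_univ i)).trans h)
  have he (a : K) : e a = ∑ ξ ∈ Γ, π (MvPolynomial.C (T ξ a) * M ξ) := by
    refine sum_congr rfl fun ξ _ => ?_
    rw [← Algebra.smul_def]
    rfl
  have hM0 : M 0 = 1 := by simp [M]
  have hMadd (ξ η : Fin m → ℕ) : M (ξ + η) = M ξ * M η := by
    simp [M, pow_add, prod_mul_distrib]
  have hΓ0 : (0 : Fin m → ℕ) ∈ Γ := (mem_Γ 0).2 (by simp)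
  refine ⟨?_, fun a b => ?_, fun a b => ?_, fun a => ?_⟩
  · rw [he, sum_eq_single_of_mem 0 hΓ0]
    · simp [T, Derivation.multiDivPow_zero, hM0]
    · intro ξ _ hξ
      simp [T, Derivation.multiDivPow_one_of_ne_zero d hξ]
  · simp only [he, ← sum_add_distrib, ← map_add, ← add_mul, T, Derivation.multiDivPow_add]
  · have hvanish (p : (Fin m → ℕ) × (Fin m → ℕ)) (hp : p.1 + p.2 ∉ Γ) :
        π (MvPolynomial.C (T p.1 a) * M p.1) * π (MvPolynomial.C (T p.2 b) * M p.2) = 0 := by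
      rw [← map_mul, mul_mul_mul_comm, ← hMadd]
      refine Ideal.Quotient.eq_zero_iff_mem.2 (Ideal.mul_mem_left _ _ ?_)
      rw [mem_Γ] at hp
      exact MvPolynomial.prod_X_pow_mem_pow_span_range_X _ (by omega)
    rw [he, he, he, sum_mul_sum, ← sum_product',
      ← sum_filter_of_ne (p := fun p => p.1 + p.2 ∈ Γ) fun p _ h => not_imp_comm.1 (hvanish p) h,
      ← sum_fiberwise_of_maps_to (t := Γ) (g := fun p : (Fin m → ℕ) × (Fin m → ℕ) => p.1 + p.2)
        fun p hp => (mem_filter.1 hp).2]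
    refine sum_congr rfl fun ξ hξ => ?_
    have hmul := Derivation.multiDivPow_mul_eq_sum_filter d ξ
      ((Γ ×ˢ Γ).filter fun p => p.1 + p.2 ∈ Γ) (fun p hp => by
        have := (mem_Γ ξ).1 hξ
        simp only [← hp, Pi.add_apply, sum_add_distrib] at this
        simp only [mem_filter, mem_product, hp]
        exact ⟨⟨(mem_Γ _).2 (by omega), (mem_Γ _).2 (by omega)⟩, hξ⟩) a b
    simp only [T, hmul, map_sum, sum_mul]
    refine sum_congr rfl fun p hp => ?_
    rw [← (mem_filter.1 hp).2, hMadd, ← map_mul π, map_mul MvPolynomial.C, mul_mul_mul_comm]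
  · rw [he, ← add_sum_erase _ _ hΓ0, hM0, mul_one]
    simp only [T, Derivation.multiDivPow_zero, add_sub_cancel_left]
    refine Ideal.sum_mem _ fun ξ hξ => Ideal.mem_map_of_mem π (Ideal.mul_mem_left _ _ ?_)
    have hpos : 1 ≤ ∑ i, ξ i := by
      refine Nat.one_le_iff_ne_zero.2 fun h => (mem_erase.1 hξ).1 ?_
      ext i
      exact sum_eq_zero_iff.1 h i (mem_univ i)
    simpa [I] using MvPolynomial.prod_X_pow_mem_pow_span_range_X (R := K) ξ hpos
end
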